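/- arXiv:math/0610510 — 2 statements merged into one kernel-verified Lean document; each statement's English description precedes it below -/
import Mathlib

section
/- Let λ be a partition, N ≥ 0, and m, k positive integers, n = 2m. Work in the field of rational functions over ℚ in indeterminates y₁,…,y_N, x₁,…,x_n. Define F(x₁,…,x_n) := ( ∏_{1≤i≤m<j≤n} (x_i^k − x_j^k)/(x_i − x_j) ) · det( s_λ(y₁,…,y_N, x_i, x_{m+j}) · (x_i − x_{m+j})/(x_i^k − x_{m+j}^k) )_{1≤i,j≤m} / ( Δ(x₁,…,x_m)·Δ(x_{m+1},…,x_n) ). Then F is a symmetric function of x₁,…,x_n: for every permutation σ ∈ S_n, F(x_{σ(1)},…,x_{σ(n)}) = F(x₁,…,x_n). -/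
open Finset

/-- The Schur polynomial for a weakly increasing index vector `μ` of length `p`,
as `det(tᵢ^{μⱼ + j - 1}) / det(tᵢ^{j-1})` (0-indexed: `det(tᵢ^{μⱼ + j}) / det(tᵢ^j)`). -/
noncomputable def schur {K : Type*} [Field K] {p : ℕ} (μ : Fin p → ℕ) (t : Fin p → K) : K :=
  Matrix.det (Matrix.of fun i j : Fin p => t i ^ (μ j + (j : ℕ))) /
    Matrix.det (Matrix.of fun i j : Fin p => t i ^ (j : ℕ))

/-- Pad a partition `v₁ ≥ v₂ ≥ … ≥ v_l` with zeros to length `p ≥ l` and rearrange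
weakly increasingly. -/
def padIncr (l p : ℕ) (v : Fin l → ℕ) : Fin p → ℕ :=
  fun j => if h : p - 1 - (j : ℕ) < l then v ⟨p - 1 - (j : ℕ), h⟩ else 0

/-- The field of rational functions over `ℚ` in `y₁,…,y_N, x₁,…,x_{2m}`. -/
abbrev RatFunc12 (N n : ℕ) : Type := FractionRing (MvPolynomial (Fin N ⊕ Fin n) ℚ)

noncomputable def Y12 (N n : ℕ) (i : Fin N) : RatFunc12 N n :=
  algebraMap (MvPolynomial (Fin N ⊕ Fin n) ℚ) _ (MvPolynomial.X (Sum.inl i))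

noncomputable def X12 (N n : ℕ) (i : Fin n) : RatFunc12 N n :=
  algebraMap (MvPolynomial (Fin N ⊕ Fin n) ℚ) _ (MvPolynomial.X (Sum.inr i))

/-- `Δ(t₁,…,t_p) = ∏_{i<j} (tᵢ - tⱼ)`. -/
noncomputable def vanderm {K : Type*} [Field K] {p : ℕ} (t : Fin p → K) : K :=
  ∏ i : Fin p, ∏ j : Fin p, if i < j then t i - t j else 1

/-- `F(x₁,…,x_n) = ∏_{1≤i≤m<j≤n} (xᵢᵏ-xⱼᵏ)/(xᵢ-xⱼ) ·
det( s_λ(y, xᵢ, x_{m+j}) (xᵢ-x_{m+j})/(xᵢᵏ-x_{m+j}ᵏ) ) / (Δ(x₁,…,x_m)Δ(x_{m+1},…,x_n))`. -/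
noncomputable def F12 (N m k l : ℕ) (v : Fin l → ℕ) (x : Fin (2 * m) → RatFunc12 N (2 * m)) :
    RatFunc12 N (2 * m) :=
  (∏ i : Fin m, ∏ j : Fin m,
      (x ⟨i.val, by omega⟩ ^ k - x ⟨m + j.val, by omega⟩ ^ k) /
        (x ⟨i.val, by omega⟩ - x ⟨m + j.val, by omega⟩)) *
    Matrix.det (Matrix.of fun i j : Fin m =>
      schur (padIncr l (N + 2) v)
          (fun p : Fin (N + 2) =>
            if h : (p : ℕ) < N then Y12 N (2 * m) ⟨p, h⟩
            else if (p : ℕ) = N then x ⟨i.val, by omega⟩ else x ⟨m + j.val, by omega⟩) *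
        (x ⟨i.val, by omega⟩ - x ⟨m + j.val, by omega⟩) /
          (x ⟨i.val, by omega⟩ ^ k - x ⟨m + j.val, by omega⟩ ^ k)) /
    (vanderm (fun i : Fin m => x ⟨i.val, by omega⟩) *
      vanderm (fun i : Fin m => x ⟨m + i.val, by omega⟩))

open Matrix in
theorem det_fromBlocks_diagonal_diagonal {R ι : Type*} [CommRing R] [Fintype ι] [DecidableEq ι]
    (f g : ι → R) (C D : Matrix ι ι R) :
    (fromBlocks (diagonal f) (diagonal g) C D).det = (D * diagonal f - C * diagonal g).det := by
  have cancel : ∀ {S : Type _} [CommRing S] (f g : ι → S) (C D : Matrix ι ι S),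
      (fromBlocks (diagonal f) (diagonal g) C D).det * ∏ i, f i =
        (D * diagonal f - C * diagonal g).det * ∏ i, f i := by
    intro S _ f g C D
    have h : fromBlocks (diagonal f) (diagonal g) C D *
        fromBlocks 1 (-diagonal g) 0 (diagonal f) =
        fromBlocks (diagonal f) 0 C (D * diagonal f - C * diagonal g) := by
      rw [fromBlocks_multiply]
      congr 1
      · simp
      · ext i j
        by_cases hij : i = j
        · subst hij; simp [mul_comm]
        · simp [hij]
      · simp
      · rw [mul_neg]; abel
    have h' := congrArg det h
    rw [det_mul, det_fromBlocks_zero₂₁, det_fromBlocks_zero₁₂] at h'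
    simpa [mul_comm] using h'
  have hreg : IsRegular (∏ i, (Polynomial.X + Polynomial.C (f i))) :=
    (Polynomial.monic_prod_of_monic _ _ fun i _ => Polynomial.monic_X_add_C (f i)).isRegular
  have hX := hreg.right (cancel (fun i => Polynomial.X + Polynomial.C (f i))
    (fun i => Polynomial.C (g i)) (C.map Polynomial.C) (D.map Polynomial.C))
  have h0 := congrArg (Polynomial.evalRingHom (0 : R)) hX
  rw [RingHom.map_det, RingHom.map_det] at h0
  convert h0 using 2
  · ext (i | i) (j | j) <;> simp [diagonal_apply, apply_ite (Polynomial.eval (0 : R))]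
  · ext i j
    simp

/-- The sign `(-1) ^ (m * (m - 1) / 2)`. -/
def pairSign (K : Type*) [Field K] (m : ℕ) : K :=
  ∏ i : Fin m, ∏ j : Fin m, if i < j then -1 else 1

theorem pairSign_sq (K : Type*) [Field K] (m : ℕ) : pairSign K m ^ 2 = 1 := by
  simp only [pairSign, ← Finset.prod_pow]
  refine Finset.prod_eq_one fun i _ => Finset.prod_eq_one fun j _ => ?_
  split_ifs <;> simp

theorem det_vandermonde_eq_prod_ite {K : Type*} [Field K] {p : ℕ} (t : Fin p → K) :
    (Matrix.vandermonde t).det = ∏ i : Fin p, ∏ j : Fin p, if i < j then t j - t i else 1 := by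
  rw [Matrix.det_vandermonde]
  refine Finset.prod_congr rfl fun i _ => ?_
  rw [← Finset.prod_filter]
  congr 1
  ext j; simp

theorem vanderm_eq_det {K : Type*} [Field K] {p : ℕ} (t : Fin p → K) :
    vanderm t = (Matrix.vandermonde fun i => -t i).det := by
  rw [det_vandermonde_eq_prod_ite, vanderm]
  simp only [neg_sub_neg]

theorem vanderm_eq_pairSign_mul_det {K : Type*} [Field K] {p : ℕ} (t : Fin p → K) :
    vanderm t = pairSign K p * (Matrix.vandermonde t).det := by
  rw [det_vandermonde_eq_prod_ite, vanderm, pairSign]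
  simp only [← Finset.prod_mul_distrib]
  refine Finset.prod_congr rfl fun i _ => Finset.prod_congr rfl fun j _ => ?_
  split_ifs <;> ring

theorem vanderm_perm {K : Type*} [Field K] {p : ℕ} (t : Fin p → K) (σ : Equiv.Perm (Fin p)) :
    vanderm (fun i => t (σ i)) = ((Equiv.Perm.sign σ : ℤ) : K) * vanderm t := by
  rw [vanderm_eq_det, vanderm_eq_det, ← Matrix.det_permute]
  rfl

theorem prod_nodalWeight_mul_det_vandermonde_sq {K : Type*} [Field K] {m : ℕ} (A : Fin m → K)
    (hA : Function.Injective A) :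
    (∏ i, Lagrange.nodalWeight Finset.univ A i) * (Matrix.vandermonde A).det ^ 2 =
      pairSign K m := by
  have hsq := pairSign_sq K m
  have hV : (Matrix.vandermonde A).det ≠ 0 := Matrix.det_vandermonde_ne_zero_iff.2 hA
  have hw : ∏ i, Lagrange.nodalWeight Finset.univ A i =
      (vanderm A * (Matrix.vandermonde A).det)⁻¹ := by
    have h2 : (Matrix.vandermonde A).det =
        ∏ i : Fin m, ∏ j : Fin m, if j < i then A i - A j else 1 := by
      rw [det_vandermonde_eq_prod_ite, Finset.prod_comm]
    rw [h2, vanderm, ← Finset.prod_mul_distrib, ← Finset.prod_inv_distrib]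
    refine Finset.prod_congr rfl fun i _ => ?_
    rw [Lagrange.nodalWeight, ← Finset.prod_mul_distrib, Finset.prod_inv_distrib]
    congr 1
    rw [← Finset.mul_prod_erase _ _ (Finset.mem_univ i)]
    simp only [lt_irrefl, if_false, one_mul]
    refine Finset.prod_congr rfl fun j hj => ?_
    rcases lt_or_gt_of_ne (Finset.ne_of_mem_erase hj) with h | h
    · simp [h, h.not_gt]
    · simp [h, h.not_gt]
  have hs : pairSign K m ≠ 0 := fun h => by simp [h] at hsq
  rw [hw, vanderm_eq_pairSign_mul_det]
  field_simp
  exact hsq.symm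

theorem sum_eval_basis_mul_pow {K : Type*} [Field K] {m : ℕ} (A : Fin m → K)
    (hA : Function.Injective A) (b : K) (c : Fin m) :
    ∑ i, (Lagrange.basis Finset.univ A i).eval b * A i ^ (c : ℕ) = b ^ (c : ℕ) := by
  have h := Lagrange.eq_interpolate_of_eval_eq (s := Finset.univ) (v := A)
    (fun i => A i ^ (c : ℕ)) (f := (Polynomial.X : Polynomial K) ^ (c : ℕ)) hA.injOn
    (by simp) (by simp)
  have h' := congrArg (Polynomial.eval b) h
  rw [Lagrange.interpolate_apply, Polynomial.eval_finsetSum] at h'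
  simpa [mul_comm] using h'.symm

open Matrix in
/-- A Cauchy-type determinant as a double alternant in the points `A` and `B`. -/
theorem det_fromBlocks_mul_pow {K : Type*} [Field K] {m : ℕ} (A B φ γ φ' γ' : Fin m → K)
    (hA : Function.Injective A) (hAB : ∀ i j, B j ≠ A i) :
    (fromBlocks (of fun i c : Fin m => φ i * A i ^ (c : ℕ))
      (of fun i c : Fin m => γ i * A i ^ (c : ℕ))
      (of fun j c : Fin m => φ' j * B j ^ (c : ℕ))
      (of fun j c : Fin m => γ' j * B j ^ (c : ℕ))).det =
    pairSign K m * (∏ i, ∏ j, (B j - A i)) *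
      (of fun i j : Fin m => (φ i * γ' j - φ' j * γ i) / (B j - A i)).det := by
  set W : Matrix (Fin m) (Fin m) K :=
    of fun j i => (Lagrange.basis Finset.univ A i).eval (B j) with hW
  have hWV (ψ : Fin m → K) : (of fun j c : Fin m => ψ j * B j ^ (c : ℕ)) =
      diagonal ψ * W * vandermonde A := by
    ext j c
    rw [Matrix.mul_assoc, diagonal_mul, of_apply, mul_apply]
    simp only [hW, of_apply, vandermonde_apply]
    rw [sum_eval_basis_mul_pow A hA]
  have hV (ψ : Fin m → K) : (of fun i c : Fin m => ψ i * A i ^ (c : ℕ)) =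
      diagonal ψ * vandermonde A := by
    ext j c
    rw [diagonal_mul, of_apply, vandermonde_apply]
  have hfac : fromBlocks (of fun i c : Fin m => φ i * A i ^ (c : ℕ))
      (of fun i c : Fin m => γ i * A i ^ (c : ℕ))
      (of fun j c : Fin m => φ' j * B j ^ (c : ℕ))
      (of fun j c : Fin m => γ' j * B j ^ (c : ℕ)) =
      fromBlocks (diagonal φ) (diagonal γ) (diagonal φ' * W) (diagonal γ' * W) *
        fromBlocks (vandermonde A) 0 0 (vandermonde A) := by
    rw [fromBlocks_multiply, hWV, hWV, hV, hV]
    simp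
  rw [hfac, det_mul, det_fromBlocks_diagonal_diagonal, det_fromBlocks_zero₁₂,
    ← prod_nodalWeight_mul_det_vandermonde_sq A hA]
  have hE : diagonal γ' * W * diagonal φ - diagonal φ' * W * diagonal γ =
      of fun j i => (∏ l, (B j - A l)) * (of fun j i => Lagrange.nodalWeight Finset.univ A i *
        (of fun i j : Fin m => (φ i * γ' j - φ' j * γ i) / (B j - A i))ᵀ j i) j i := by
    ext j i
    have := Lagrange.eval_basis_not_at_node (s := Finset.univ) (v := A) (x := B j) (i := i)
      (Finset.mem_univ i) (hAB i j)
    simp only [Matrix.sub_apply, mul_diagonal, diagonal_mul, hW, of_apply, transpose_apply, this,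
      Lagrange.eval_nodal]
    ring
  rw [hE, det_mul_column, det_mul_row, det_transpose, Finset.prod_comm (f := fun i j => B j - A i)]
  ring

open Matrix in
/-- As a function of its last two rows, a determinant is a wedge of two functionals. -/
theorem exists_det_sumElim_eq {K ι : Type*} [Field K] [Fintype ι] [DecidableEq ι]
    (Y : ι → ι ⊕ Fin 2 → K) :
    ∃ f g : (ι ⊕ Fin 2 → K) → K, ∀ a b,
      (of (Sum.elim Y ![a, b])).det = f a * g b - f b * g a := by
  by_cases h : ∃ c d, (of (Sum.elim Y ![c, d])).det ≠ 0
  · obtain ⟨c, d, h⟩ := h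
    set P := of (Sum.elim Y ![c, d]) with hP
    have hunit : IsUnit P.det := isUnit_iff_ne_zero.2 h
    refine ⟨fun a => (a ᵥ* P⁻¹) (Sum.inr 0) * P.det, fun a => (a ᵥ* P⁻¹) (Sum.inr 1),
      fun a b => ?_⟩
    have hM : of (Sum.elim Y ![a, b]) = fromBlocks 1 0
        (of fun i j => (![a, b] i ᵥ* P⁻¹) (Sum.inl j))
        (of fun i j => (![a, b] i ᵥ* P⁻¹) (Sum.inr j)) * P := by
      have hrow (i : ι) (j : ι ⊕ Fin 2) :
          (of (Sum.elim Y ![a, b]) * P⁻¹) (Sum.inl i) j =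
            (1 : Matrix (ι ⊕ Fin 2) _ K) (Sum.inl i) j := by
        rw [← mul_nonsing_inv P hunit]
        rfl
      have hmul : of (Sum.elim Y ![a, b]) * P⁻¹ = fromBlocks 1 0
          (of fun i j => (![a, b] i ᵥ* P⁻¹) (Sum.inl j))
          (of fun i j => (![a, b] i ᵥ* P⁻¹) (Sum.inr j)) := by
        ext (i | i) (j | j)
        · rw [hrow]; simp [one_apply]
        · rw [hrow]; simp
        · rfl
        · rfl
      rw [← hmul, nonsing_inv_mul_cancel_right _ _ hunit]
    rw [hM, det_mul, det_fromBlocks_zero₁₂, det_one, one_mul, det_fin_two]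
    simp
    ring
  · push Not at h
    exact ⟨0, 0, fun a b => by simp [h]⟩

/-- The point `(y₁, …, y_N, a, b)`. -/
def appendPair {K : Type*} {N : ℕ} (y : Fin N → K) (a b : K) : Fin (N + 2) → K :=
  fun p => if h : (p : ℕ) < N then y ⟨p, h⟩ else if (p : ℕ) = N then a else b

theorem appendPair_finSumFinEquiv {K : Type*} {N : ℕ} (y : Fin N → K) (a b : K)
    (p : Fin N ⊕ Fin 2) : appendPair y a b (finSumFinEquiv p) = Sum.elim y ![a, b] p := by
  rcases p with p | p
  · simp [appendPair]
  · fin_cases p <;> simp [appendPair]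

theorem det_vandermonde_appendPair {K : Type*} [Field K] {N : ℕ} (y : Fin N → K) (a b : K) :
    (Matrix.vandermonde (appendPair y a b)).det =
      (Matrix.vandermonde y).det * (∏ i, (a - y i)) * (∏ i, (b - y i)) * (b - a) := by
  simp only [det_vandermonde_eq_prod_ite, Fin.prod_univ_castSucc]
  have h1 (i : Fin N) : appendPair y a b i.castSucc.castSucc = y i := by simp [appendPair]
  have h2 : appendPair y a b (Fin.last N).castSucc = a := by simp [appendPair]
  have h3 : appendPair y a b (Fin.last (N + 1)) = b := by simp [appendPair]
  simp [h1, h2, h3, Fin.castSucc_lt_last, Finset.prod_mul_distrib, Fin.le_last, not_lt_of_ge]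

open Matrix in
theorem exists_det_pow_appendPair_eq {K : Type*} [Field K] {N : ℕ} (e : Fin (N + 2) → ℕ)
    (y : Fin N → K) :
    ∃ f g : K → K, ∀ a b, (of fun i j => appendPair y a b i ^ e j).det = f a * g b - f b * g a := by
  let u (a : K) : Fin N ⊕ Fin 2 → K := fun j => a ^ e (finSumFinEquiv j)
  obtain ⟨f, g, h⟩ := exists_det_sumElim_eq fun i => u (y i)
  refine ⟨fun a => f (u a), fun a => g (u a), fun a b => ?_⟩
  rw [← h, ← det_submatrix_equiv_self finSumFinEquiv]
  congr 1
  ext (i | i) j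
  · simp [appendPair_finSumFinEquiv, u, -finSumFinEquiv_apply_left]
  · fin_cases i <;> simp [appendPair_finSumFinEquiv, u, -finSumFinEquiv_apply_right]

theorem exists_schur_appendPair_mul_sub_eq {K : Type*} [Field K] {N : ℕ} (μ : Fin (N + 2) → ℕ)
    (y : Fin N → K) :
    ∃ φ γ : K → K, ∀ a b, schur μ (appendPair y a b) * (a - b) = φ a * γ b - φ b * γ a := by
  obtain ⟨f, g, h⟩ := exists_det_pow_appendPair_eq (fun j => μ j + (j : ℕ)) y
  refine ⟨fun a => -f a * (Matrix.vandermonde y).det⁻¹ * (∏ i, (a - y i))⁻¹,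
    fun a => g a * (∏ i, (a - y i))⁻¹, fun a b => ?_⟩
  have hV : (Matrix.of fun i j : Fin (N + 2) => appendPair y a b i ^ (j : ℕ)) =
    Matrix.vandermonde (appendPair y a b) := rfl
  rw [schur, h, hV, det_vandermonde_appendPair]
  rcases eq_or_ne a b with rfl | hab
  · simp
  · have hab' : b - a ≠ 0 := sub_ne_zero.2 hab.symm
    simp only [div_eq_mul_inv, mul_inv]
    have : (b - a)⁻¹ * (a - b) = -1 := by field_simp; ring
    linear_combination (f a * g b - f b * g a) *
      ((Matrix.vandermonde y).det⁻¹ * (∏ i, (a - y i))⁻¹ *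
        (∏ i, (b - y i))⁻¹) * this

theorem X12_pow_injective {N n k : ℕ} (hk : 1 ≤ k) :
    Function.Injective fun i => X12 N n i ^ k := by
  intro i j hij
  simp only [X12, ← map_pow] at hij
  have h := IsFractionRing.injective (MvPolynomial (Fin N ⊕ Fin n) ℚ) _ hij
  by_contra hne
  have h' := congrArg (MvPolynomial.eval fun s => if s = Sum.inr i then (1 : ℚ) else 0) h
  simp [Ne.symm hne, Nat.ne_of_gt hk] at h'

/-- The index equivalence splitting `x₁,…,x_{2m}` into two halves. -/
def halves (m : ℕ) : Fin m ⊕ Fin m ≃ Fin (2 * m) :=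
  finSumFinEquiv.trans (finCongr (two_mul m).symm)

theorem vanderm_halves {K : Type*} [Field K] {m : ℕ} (x : Fin (2 * m) → K) :
    vanderm x = vanderm (fun i => x (halves m (Sum.inl i))) *
      vanderm (fun i => x (halves m (Sum.inr i))) *
        ∏ i, ∏ j, (x (halves m (Sum.inl i)) - x (halves m (Sum.inr j))) := by
  unfold vanderm
  simp only [← (halves m).prod_comp, Fintype.prod_sum_type, Finset.prod_mul_distrib]
  have h1 (i j : Fin m) : halves m (Sum.inl i) < halves m (Sum.inl j) ↔ i < j := by
    simp [halves, Fin.lt_def, -Fin.val_fin_lt]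
  have h2 (i j : Fin m) : halves m (Sum.inr i) < halves m (Sum.inr j) ↔ i < j := by
    simp [halves]
  have h3 (i j : Fin m) : halves m (Sum.inl i) < halves m (Sum.inr j) := by
    simp only [halves, Fin.lt_def, Equiv.trans_apply, finSumFinEquiv_apply_left,
      finSumFinEquiv_apply_right, finCongr_apply, Fin.val_cast, Fin.val_castAdd, Fin.val_natAdd]
    omega
  have h4 (i j : Fin m) : ¬ halves m (Sum.inr i) < halves m (Sum.inl j) := by
    simp only [halves, Fin.lt_def, Equiv.trans_apply, finSumFinEquiv_apply_left,
      finSumFinEquiv_apply_right, finCongr_apply, Fin.val_cast, Fin.val_castAdd, Fin.val_natAdd]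
    omega
  simp only [h1, h2, h3, h4, if_true, if_false, Finset.prod_const_one]
  ring

open Matrix in
/-- `F` is a constant multiple of a quotient of two alternants in `x₁,…,x_{2m}`. -/
theorem exists_F12_eq (N m k l : ℕ) (v : Fin l → ℕ) :
    ∃ (c : RatFunc12 N (2 * m)) (u : RatFunc12 N (2 * m) → Fin m ⊕ Fin m → RatFunc12 N (2 * m)),
      ∀ x : Fin (2 * m) → RatFunc12 N (2 * m), (Function.Injective fun i => x i ^ k) →
        F12 N m k l v x =
          c * (of fun p q : Fin (2 * m) => u (x p) ((halves m).symm q)).det / vanderm x := by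
  obtain ⟨φ, γ, h⟩ := exists_schur_appendPair_mul_sub_eq (padIncr l (N + 2) v) (Y12 N (2 * m))
  refine ⟨(∏ _i : Fin m, ∏ _j : Fin m, -1) * pairSign _ m, fun a =>
    Sum.elim (fun j => γ a * (a ^ k) ^ (j : ℕ)) (fun j => φ a * (a ^ k) ^ (j : ℕ)), fun x hx => ?_⟩
  have hs : pairSign (RatFunc12 N (2 * m)) m * pairSign (RatFunc12 N (2 * m)) m = 1 := by
    rw [← pow_two, pairSign_sq]
  set a : Fin m → RatFunc12 N (2 * m) := fun i => x (halves m (Sum.inl i)) with ha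
  set b : Fin m → RatFunc12 N (2 * m) := fun i => x (halves m (Sum.inr i)) with hb
  have hdet := det_fromBlocks_mul_pow (fun i => a i ^ k) (fun i => b i ^ k)
    (fun i => γ (a i)) (fun i => φ (a i)) (fun i => γ (b i)) (fun i => φ (b i))
    (fun i j hij => by simpa using hx hij) (fun i j hij => by simpa using hx hij)
  have hM : (of fun p q : Fin (2 * m) =>
      Sum.elim (fun j : Fin m => γ (x p) * (x p ^ k) ^ (j : ℕ))
        (fun j : Fin m => φ (x p) * (x p ^ k) ^ (j : ℕ)) ((halves m).symm q)).det =
      (fromBlocks (of fun i c : Fin m => γ (a i) * (a i ^ k) ^ (c : ℕ))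
        (of fun i c : Fin m => φ (a i) * (a i ^ k) ^ (c : ℕ))
        (of fun j c : Fin m => γ (b j) * (b j ^ k) ^ (c : ℕ))
        (of fun j c : Fin m => φ (b j) * (b j ^ k) ^ (c : ℕ))).det := by
    rw [← det_submatrix_equiv_self (halves m)]
    congr 1
    ext (i | i) (j | j) <;> simp [ha, hb]
  have hF : F12 N m k l v x = (∏ i, ∏ j, (a i ^ k - b j ^ k) / (a i - b j)) *
      (of fun i j => schur (padIncr l (N + 2) v) (appendPair (Y12 N (2 * m)) (a i) (b j)) *
        (a i - b j) / (a i ^ k - b j ^ k)).det / (vanderm a * vanderm b) := rfl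
  have hentry (i j : Fin m) :
      schur (padIncr l (N + 2) v) (appendPair (Y12 N (2 * m)) (a i) (b j)) *
        (a i - b j) / (a i ^ k - b j ^ k) =
      (γ (a i) * φ (b j) - γ (b j) * φ (a i)) / (b j ^ k - a i ^ k) := by
    rw [h, ← neg_sub (b j ^ k), div_neg, ← neg_div]
    ring
  have hprod : ∏ i, ∏ j, (a i ^ k - b j ^ k) =
      (∏ _i : Fin m, ∏ _j : Fin m, (-1)) * ∏ i, ∏ j, (b j ^ k - a i ^ k) := by
    simp only [← Finset.prod_mul_distrib]
    refine Finset.prod_congr rfl fun i _ => Finset.prod_congr rfl fun j _ => by ring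
  have hcancel (r P D : RatFunc12 N (2 * m)) :
      r * pairSign _ m * (pairSign _ m * P * D) = r * (P * D) := by
    linear_combination r * P * D * hs
  rw [hF, hM, hdet, hcancel, vanderm_halves x]
  simp only [hentry, Finset.prod_div_distrib, hprod]
  simp only [div_eq_mul_inv, mul_inv]
  ring

/-- `F` is a symmetric function of `x₁,…,x_n`. -/
theorem F12_symmetric (N m k l : ℕ) (hm : 1 ≤ m) (hk : 1 ≤ k)
    (v : Fin l → ℕ) (hv : Antitone v) (hl : l ≤ N + 2)
    (σ : Equiv.Perm (Fin (2 * m))) :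
    F12 N m k l v (fun j => X12 N (2 * m) (σ j)) = F12 N m k l v (X12 N (2 * m)) := by
  obtain ⟨c, u, h⟩ := exists_F12_eq N m k l v
  have hX := X12_pow_injective (N := N) (n := 2 * m) hk
  rw [h _ hX, h _ (hX.comp σ.injective), vanderm_perm]
  have hdet : (Matrix.of fun p q : Fin (2 * m) =>
      u (X12 N (2 * m) (σ p)) ((halves m).symm q)).det =
      ((Equiv.Perm.sign σ : ℤ) : RatFunc12 N (2 * m)) * (Matrix.of fun p q : Fin (2 * m) =>
        u (X12 N (2 * m) p) ((halves m).symm q)).det := by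
    rw [← Matrix.det_permute]
    rfl
  rw [hdet, mul_left_comm, mul_div_mul_left]
  rcases Int.units_eq_one_or (Equiv.Perm.sign σ) with hs | hs <;> simp [hs]
end

section
/- Let m, r be positive integers, N ≥ 0, n = 2m, and let ρ denote the staircase partition (r, r−1, …, 2, 1). Work in the field of rational functions over ℚ in indeterminates y₁,…,y_N, x₁,…,x_n. Then det( s_ρ(y₁,…,y_N, x_i, x_{m+j}) / (x_i + x_{m+j}) )_{1≤i,j≤m} = ( Δ(x₁,…,x_m) · Δ(x_{m+1},…,x_n) / ∏_{1≤i≤m<j≤n} (x_i + x_j) ) · ( s_ρ(y₁,…,y_N) )^{m−1} · s_ρ(y₁,…,y_N, x₁,…,x_n). -/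
open Finset

/-- The staircase partition `ρ = (r, r-1, …, 2, 1)`. -/
def staircase (r : ℕ) : Fin r → ℕ := fun i => r - (i : ℕ)

/-- The field of rational functions over `ℚ` in `y₁,…,y_N, x₁,…,x_n`. -/
abbrev RatFunc14 (N n : ℕ) : Type := FractionRing (MvPolynomial (Fin N ⊕ Fin n) ℚ)

noncomputable def Y14 (N n : ℕ) (i : Fin N) : RatFunc14 N n :=
  algebraMap (MvPolynomial (Fin N ⊕ Fin n) ℚ) _ (MvPolynomial.X (Sum.inl i))

noncomputable def X14 (N n : ℕ) (i : Fin n) : RatFunc14 N n :=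
  algebraMap (MvPolynomial (Fin N ⊕ Fin n) ℚ) _ (MvPolynomial.X (Sum.inr i))

/-- The alternant `det (tᵢ ^ eⱼ)` with exponents `e` at the points `t`. -/
noncomputable def alternant {K ι : Type*} [Field K] [Fintype ι] [DecidableEq ι]
    (e : ι → ℕ) (t : ι → K) : K :=
  Matrix.det (Matrix.of fun i j => t i ^ e j)

/-- The exponents `e + 2m` together with `0, 1, …, 2m - 1`. -/
def extExp {N : ℕ} (e : Fin N → ℕ) (m : ℕ) : Fin N ⊕ (Fin m ⊕ Fin m) → ℕ :=
  Sum.elim (fun l => e l + 2 * m) (Sum.elim (fun i => i) (fun i => m + i))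

/-- The points `y, x, z` as one family. -/
def joinPts {K : Type*} {N m : ℕ} (y : Fin N → K) (x z : Fin m → K) :
    Fin N ⊕ (Fin m ⊕ Fin m) → K :=
  Sum.elim y (Sum.elim x z)

section Alternant

open Polynomial Matrix

variable {K ι : Type*} [Field K] [Fintype ι] [DecidableEq ι]

theorem det_eval_eq_alternant_mul {e : ι → ℕ} (he : Function.Injective e) (f : ι → K[X])
    (hf : ∀ l k, (f l).coeff k ≠ 0 → k ∈ Set.range e) (t : ι → K) :
    (of fun i l => (f l).eval (t i)).det =
      alternant e t * (of fun a l => (f l).coeff (e a)).det := by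
  rw [alternant, ← det_mul]
  congr 1
  ext i l
  simp only [of_apply, mul_apply]
  have hs : (f l).support ⊆ univ.map ⟨e, he⟩ := by
    intro k hk
    obtain ⟨a, rfl⟩ := hf l k (mem_support_iff.1 hk)
    simp
  rw [eval_eq_sum, Polynomial.sum, Finset.sum_subset hs, Finset.sum_map]
  · exact Finset.sum_congr rfl fun a _ => mul_comm _ _
  · intro k _ hk
    simp [notMem_support_iff.1 hk]

theorem alternant_eq_det_eval {e : ι → ℕ} (he : Function.Injective e) (f : ι → K[X])
    (hf : ∀ l k, (f l).coeff k ≠ 0 → k ∈ Set.range e) (hmon : ∀ l, (f l).Monic)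
    (hdeg : ∀ l, (f l).natDegree = e l) (t : ι → K) :
    alternant e t = (of fun i l => (f l).eval (t i)).det := by
  have hC : (of fun a l => (f l).coeff (e a)).det = 1 := by
    let _ : LinearOrder ι := LinearOrder.lift' e he
    rw [det_of_isUpperTriangular]
    · refine Finset.prod_eq_one fun a _ => ?_
      rw [of_apply, ← hdeg a]
      exact hmon a
    · intro a l hal
      exact coeff_eq_zero_of_natDegree_lt ((hdeg l).trans_lt hal)
  rw [det_eval_eq_alternant_mul he f hf, hC, mul_one]

theorem exists_eval_eq_alternant_update (e : ι → ℕ) (t : ι → K) (i : ι) :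
    ∃ φ : K[X], (∀ k, φ.coeff k ≠ 0 → k ∈ Set.range e) ∧
      ∀ s, φ.eval s = alternant e (Function.update t i s) := by
  refine ⟨∑ a, C (adjugate (of fun i j => t i ^ e j) a i) * X ^ e a, fun k hk => ?_, fun s => ?_⟩
  · by_contra h
    apply hk
    rw [finsetSum_coeff]
    refine Finset.sum_eq_zero fun a _ => ?_
    rw [coeff_C_mul_X_pow, if_neg]
    rintro rfl
    exact h ⟨a, rfl⟩
  · have hM : (of fun i' j => Function.update t i s i' ^ e j) =
        (of fun i j => t i ^ e j).updateRow i fun j => s ^ e j := by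
      ext a b
      by_cases h : a = i
      · subst h; simp
      · simp [h]
    rw [alternant, hM, det_eq_sum_mul_adjugate_row _ i, eval_finsetSum]
    refine Finset.sum_congr rfl fun a _ => ?_
    rw [eval_mul, eval_C, eval_pow, eval_X, adjugate_apply, adjugate_apply, updateRow_idem,
      updateRow_self, mul_comm]

theorem alternant_eq_zero (e : ι → ℕ) {t : ι → K} {i j : ι} (hij : i ≠ j) (h : t i = t j) :
    alternant e t = 0 :=
  det_zero_of_row_eq hij (by ext; simp [h])

theorem alternant_comp_equiv {κ : Type*} [Fintype κ] [DecidableEq κ] (σ τ : κ ≃ ι) (e : ι → ℕ)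
    (t : ι → K) :
    alternant (e ∘ τ) (t ∘ σ) = (Equiv.Perm.sign (τ.symm.trans σ) : ℤ) * alternant e t := by
  have : (of fun i j => (t ∘ σ) i ^ (e ∘ τ) j) =
      (((of fun i j => t i ^ e j).submatrix (τ.symm.trans σ) id).submatrix τ τ) := by
    ext; simp
  rw [alternant, this, det_submatrix_equiv_self, det_permute, alternant]

theorem alternant_ne_zero {p : ℕ} (τ : ι ≃ Fin p) {t : ι → K} (ht : Function.Injective t) :
    alternant (fun i => (τ i : ℕ)) t ≠ 0 := by
  have h := alternant_comp_equiv τ τ (fun i : Fin p => (i : ℕ)) (t ∘ τ.symm)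
  have hv : alternant (fun i : Fin p => (i : ℕ)) (t ∘ τ.symm) =
    (vandermonde (t ∘ τ.symm)).det := rfl
  have ht' : (t ∘ τ.symm) ∘ τ = t := by ext; simp
  rw [ht'] at h
  change alternant ((fun i : Fin p => (i : ℕ)) ∘ τ) t ≠ 0
  rw [h, Equiv.symm_trans_self, hv]
  simpa [det_vandermonde_eq_zero_iff] using
    det_vandermonde_ne_zero_iff.2 (ht.comp τ.symm.injective)

end Alternant

section ExtExp

open Polynomial Matrix

variable {K : Type*} [Field K] {N m : ℕ} {e : Fin N → ℕ}

theorem mem_range_extExp {k : ℕ} :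
    k ∈ Set.range (extExp e m) ↔ k < 2 * m ∨ ∃ l, e l + 2 * m = k := by
  constructor
  · rintro ⟨l | i | i, rfl⟩
    · exact .inr ⟨l, rfl⟩
    · left; simp only [extExp, Sum.elim_inr, Sum.elim_inl]; omega
    · left; simp only [extExp, Sum.elim_inr]; omega
  · rintro (h | ⟨l, rfl⟩)
    · by_cases hk : k < m
      · exact ⟨.inr (.inl ⟨k, hk⟩), rfl⟩
      · exact ⟨.inr (.inr ⟨k - m, by omega⟩), by simp only [extExp, Sum.elim_inr]; omega⟩
    · exact ⟨.inl l, rfl⟩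

theorem extExp_injective (he : Function.Injective e) : Function.Injective (extExp e m) := by
  rintro (a | a | a) (b | b | b) h <;> simp only [extExp, Sum.elim_inl, Sum.elim_inr] at h
  · rw [he (Nat.add_right_cancel h)]
  all_goals first | omega | (congr 2; omega)

/-- The exponents that are at least `2` are exponents raised by `2`. -/
def StepTwo (e : Fin N → ℕ) : Prop := ∀ l, e l < 2 ∨ ∃ i, e i + 2 = e l

theorem coeff_sq_sub_mul_mem (he : StepTwo e) {f : K[X]} (a : K)
    (hf : ∀ k, f.coeff k ≠ 0 → k ∈ Set.range (extExp e m)) :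
    ∀ k, ((X ^ 2 - C a) * f).coeff k ≠ 0 → k ∈ Set.range (extExp e (m + 1)) := by
  intro k hk
  simp only [mem_range_extExp] at hf ⊢
  rw [sub_mul, coeff_sub, coeff_C_mul, coeff_X_pow_mul'] at hk
  by_cases h0 : f.coeff k = 0
  · rw [h0, mul_zero, sub_zero] at hk
    split_ifs at hk with h2
    · rcases hf _ hk with h | ⟨l, h⟩
      · left; omega
      · right; exact ⟨l, by omega⟩
    · exact absurd rfl hk
  · rcases hf _ h0 with h | ⟨l, h⟩
    · left; omega
    · rcases he l with h' | ⟨i, hi⟩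
      · left; omega
      · right; exact ⟨i, by omega⟩

theorem coeff_prod_sq_sub_mul_mem {α : Type*} (he : StepTwo e) {f : K[X]} (a : α → K)
    (s : Finset α) (hf : ∀ k, f.coeff k ≠ 0 → k ∈ Set.range (extExp e m)) :
    ∀ k, ((∏ i ∈ s, (X ^ 2 - C (a i))) * f).coeff k ≠ 0 →
      k ∈ Set.range (extExp e (m + s.card)) := by
  classical
  induction s using Finset.induction_on with
  | empty => simpa using hf
  | insert b s hb ih =>
    rw [Finset.prod_insert hb, Finset.card_insert_of_notMem hb, mul_assoc, ← add_assoc]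
    exact coeff_sq_sub_mul_mem he _ ih

theorem alternant_extExp (he : Function.Injective e) {P : K[X]} (hP : P.Monic)
    (hdeg : P.natDegree = 2 * m)
    (hsupp : ∀ l k, (P * X ^ e l).coeff k ≠ 0 → k ∈ Set.range (extExp e m))
    (y : Fin N → K) (x z : Fin m → K) (hx : ∀ i, P.eval (x i) = 0) (hz : ∀ i, P.eval (z i) = 0) :
    alternant (extExp e m) (joinPts y x z) = (∏ i, P.eval (y i)) * alternant e y *
      alternant (Sum.elim (fun i : Fin m => (i : ℕ)) (fun i : Fin m => m + i))
        (Sum.elim x z) := by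
  rw [alternant_eq_det_eval (extExp_injective he)
    (Sum.elim (fun l => P * X ^ e l) fun a => X ^ extExp e m (.inr a))]
  · rw [alternant, ← det_mul_column, alternant, ← det_fromBlocks_zero₂₁ _
      (of fun i a => y i ^ extExp e m (.inr a))]
    congr 1
    ext (i | i | i) (l | a)
    · simp [joinPts]
    · simp [joinPts]
    · simp [joinPts, hx]
    · rcases a with a | a <;> simp [joinPts, extExp]
    · simp [joinPts, hz]
    · rcases a with a | a <;> simp [joinPts, extExp]
  · rintro (l | a) k hk
    · exact hsupp l k hk
    · simp only [Sum.elim_inr, coeff_X_pow] at hk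
      exact ⟨.inr a, by by_contra h; exact hk (if_neg (Ne.symm h))⟩
  · rintro (l | a)
    · exact hP.mul (monic_X_pow _)
    · exact monic_X_pow _
  · rintro (l | a)
    · simp [hP.natDegree_mul (monic_X_pow (e l)), hdeg, extExp, add_comm]
    · simp

end ExtExp

section Factorization

open Polynomial Matrix

variable {K : Type*} [Field K] {N m : ℕ} {e : Fin N → ℕ}

/-- The alternant of the points `x, z` with exponents `0, 1, …, 2m - 1`. -/
noncomputable def pairVandermonde (x z : Fin m → K) : K :=
  alternant (Sum.elim (fun i : Fin m => (i : ℕ)) (fun i : Fin m => m + i)) (Sum.elim x z)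

theorem pairVandermonde_ne_zero {x z : Fin m → K} (h : Function.Injective (Sum.elim x z)) :
    pairVandermonde x z ≠ 0 := by
  have he : (Sum.elim (fun i : Fin m => (i : ℕ)) (fun i : Fin m => m + i)) =
      fun a => ((finSumFinEquiv a : Fin (m + m)) : ℕ) := by
    ext (a | a) <;> simp [add_comm]
  rw [pairVandermonde, he]
  exact alternant_ne_zero finSumFinEquiv h

theorem coeff_X_pow_mem_range_extExp_zero (l : Fin N) :
    ∀ k, (X ^ e l : K[X]).coeff k ≠ 0 → k ∈ Set.range (extExp e 0) := by
  intro k hk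
  rw [coeff_X_pow] at hk
  exact mem_range_extExp.2 (.inr ⟨l, by by_contra h; exact hk (if_neg (Ne.symm h))⟩)

theorem coeff_prod_sq_sub_mul_X_pow_mem (h2 : StepTwo e) (z : Fin m → K) (l : Fin N) :
    ∀ k, ((∏ i, (X ^ 2 - C (z i ^ 2))) * X ^ e l).coeff k ≠ 0 →
      k ∈ Set.range (extExp e m) := by
  have h := coeff_prod_sq_sub_mul_mem h2 (fun k => z k ^ 2) univ
    (coeff_X_pow_mem_range_extExp_zero (K := K) l)
  rwa [Finset.card_univ, Fintype.card_fin, zero_add] at h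

theorem alternant_neg_pair (he : Function.Injective e) (h2 : StepTwo e) (y : Fin N → K)
    (z : Fin m → K) :
    alternant (extExp e m) (joinPts y (fun i => -z i) z) =
      (∏ i, ∏ k, (y i ^ 2 - z k ^ 2)) * alternant e y * pairVandermonde (fun i => -z i) z := by
  have hmon : (∏ k, (X ^ 2 - C (z k ^ 2))).Monic :=
    monic_prod_of_monic _ _ fun k _ => monic_X_pow_sub_C _ two_ne_zero
  have heval : ∀ s, (∏ k, (X ^ 2 - C (z k ^ 2))).eval s = ∏ k, (s ^ 2 - z k ^ 2) := fun s => by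
    simp only [eval_prod, eval_sub, eval_pow, eval_X, eval_C]
  have hdeg : (∏ k, (X ^ 2 - C (z k ^ 2))).natDegree = 2 * m := by
    rw [natDegree_prod_of_monic _ _ fun k _ => monic_X_pow_sub_C _ two_ne_zero]
    simp only [natDegree_X_pow_sub_C, Finset.sum_const, Finset.card_univ, Fintype.card_fin,
      smul_eq_mul, mul_comm]
  have hz : ∀ i, (∏ k, (X ^ 2 - C (z k ^ 2))).eval (z i) = 0 := fun i => by
    rw [heval]
    exact Finset.prod_eq_zero (Finset.mem_univ i) (sub_self _)
  rw [alternant_extExp he hmon hdeg (coeff_prod_sq_sub_mul_X_pow_mem h2 z) y (fun i => -z i) z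
    (fun i => by rw [heval, neg_sq, ← heval, hz]) hz, pairVandermonde]
  simp only [heval]

theorem alternant_val_pair (y : Fin N → K) (a b : K) :
    alternant (extExp (fun l : Fin N => (l : ℕ)) 1) (joinPts y (fun _ => a) (fun _ => b)) =
      (∏ i, (y i - a)) * (∏ i, (y i - b)) * alternant (fun l : Fin N => (l : ℕ)) y * (b - a) := by
  rw [alternant_extExp (P := (X - C a) * (X - C b)) Fin.val_injective
    ((monic_X_sub_C a).mul (monic_X_sub_C b))]
  · have : alternant (Sum.elim (fun i : Fin 1 => (i : ℕ)) (fun i : Fin 1 => 1 + i))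
        (Sum.elim (fun _ => a) (fun _ => b)) = b - a := by
      rw [alternant, ← det_submatrix_equiv_self finSumFinEquiv.symm,
        det_fin_two (_ : Matrix (Fin 2) (Fin 2) K)]
      have h0 : (finSumFinEquiv (m := 1) (n := 1)).symm 0 = .inl 0 := rfl
      have h1 : (finSumFinEquiv (m := 1) (n := 1)).symm 1 = .inr 0 := rfl
      simp [h0, h1]
    rw [this]
    simp [Finset.prod_mul_distrib]
  · rw [(monic_X_sub_C a).natDegree_mul (monic_X_sub_C b)]
    simp
  · intro l k hk
    rw [mem_range_extExp]
    have hle := le_natDegree_of_ne_zero hk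
    rw [((monic_X_sub_C a).mul (monic_X_sub_C b)).natDegree_mul (monic_X_pow _),
      (monic_X_sub_C a).natDegree_mul (monic_X_sub_C b)] at hle
    simp only [natDegree_X_sub_C, natDegree_X_pow] at hle
    by_cases h : k < 2 * 1
    · exact .inl h
    · exact .inr ⟨⟨k - 2, by omega⟩, by simp only; omega⟩
  · simp
  · simp

theorem alternant_mul_prod_eq (he : Function.Injective e) (h2 : StepTwo e) (y : Fin N → K)
    (x z : Fin m → K) (hyz : ∀ i k, y i ^ 2 - z k ^ 2 ≠ 0) (hy : alternant e y ≠ 0)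
    (hz : Function.Injective fun k => z k ^ 2)
    (hzz : ∀ k, Function.Injective
      (Sum.elim (fun _ : Fin 1 => z k) (fun _ : Fin 1 => - z k))) :
    alternant (extExp e m) (joinPts y x z) *
        ∏ j, (alternant (extExp e 1) (joinPts y (fun _ => -z j) (fun _ => z j)) *
          ∏ k ∈ univ.erase j, (z j ^ 2 - z k ^ 2)) =
      alternant (extExp e m) (joinPts y (fun i => -z i) z) *
        (of fun i j => alternant (extExp e 1) (joinPts y (fun _ => x i) (fun _ => z j)) *
          ∏ k ∈ univ.erase j, (x i ^ 2 - z k ^ 2)).det := by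
  have hψ : ∀ w : K, ∃ φ : K[X], (∀ k, φ.coeff k ≠ 0 → k ∈ Set.range (extExp e 1)) ∧
      ∀ s, φ.eval s = alternant (extExp e 1) (joinPts y (fun _ => s) (fun _ => w)) := by
    intro w
    obtain ⟨φ, h, h'⟩ := exists_eval_eq_alternant_update (extExp e 1)
      (joinPts y (fun _ => 0) (fun _ => w)) (.inr (.inl 0))
    refine ⟨φ, h, fun s => (h' s).trans ?_⟩
    congr 1
    ext (i | i | i)
    · rfl
    · rw [Subsingleton.elim i 0]
      simp [joinPts]
    · rfl
  choose ψ hsupp hψ using hψ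
  have hψy : ∀ w i, (ψ w).eval (y i) = 0 := fun w i => by
    rw [hψ]
    exact alternant_eq_zero _ (i := .inl i) (j := .inr (.inl 0)) (by simp) rfl
  have hψw : ∀ w, (ψ w).eval w = 0 := fun w => by
    rw [hψ]
    exact alternant_eq_zero _ (i := .inr (.inl 0)) (j := .inr (.inr 0)) (by simp) rfl
  set Q : Fin m → K[X] := fun j => ∏ k ∈ univ.erase j, (X ^ 2 - C (z k ^ 2)) with hQ
  have hQe : ∀ j s, (Q j).eval s = ∏ k ∈ univ.erase j, (s ^ 2 - z k ^ 2) := fun j s => by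
    simp [hQ, eval_prod]
  have hQ0 : ∀ i j, i ≠ j → (Q j).eval (z i) = 0 := fun i j hij => by
    rw [hQe]
    exact Finset.prod_eq_zero (Finset.mem_erase.2 ⟨hij, Finset.mem_univ i⟩) (sub_self _)
  set P : K[X] := ∏ k, (X ^ 2 - C (z k ^ 2)) with hP
  have hPe : ∀ s, P.eval s = ∏ k, (s ^ 2 - z k ^ 2) := fun s => by simp [hP, eval_prod]
  have hP0 : ∀ i, P.eval (z i) = 0 := fun i => by
    rw [hPe]
    exact Finset.prod_eq_zero (Finset.mem_univ i) (sub_self _)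
  set Φ : Fin N ⊕ (Fin m ⊕ Fin m) → K[X] := Sum.elim (fun l => P * X ^ e l)
    (Sum.elim (fun j => Q j * ψ (z j)) (fun j => Q j * ψ (-z j))) with hΦ
  have hQψ : ∀ j w k, (Q j * ψ w).coeff k ≠ 0 → k ∈ Set.range (extExp e m) := by
    intro j w
    have := coeff_prod_sq_sub_mul_mem h2 (fun k => z k ^ 2) (univ.erase j) (hsupp w)
    have hm : 1 + (univ.erase j).card = m := by
      rw [Finset.card_erase_of_mem (Finset.mem_univ j), Finset.card_univ, Fintype.card_fin]
      have := j.isLt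
      omega
    rwa [hm] at this
  have hΦs : ∀ l k, (Φ l).coeff k ≠ 0 → k ∈ Set.range (extExp e m) := by
    rintro (l | j | j)
    · exact coeff_prod_sq_sub_mul_X_pow_mem h2 z l
    · exact hQψ j _
    · exact hQψ j _
  have key : ∀ x : Fin m → K, (of fun i l => (Φ l).eval (joinPts y x z i)).det =
      ((∏ i, P.eval (y i)) * alternant e y) *
        ((of fun i j => (ψ (z j)).eval (x i) * (Q j).eval (x i)).det *
          ∏ j, ((Q j).eval (z j) * (ψ (-z j)).eval (z j))) := by
    intro x
    rw [alternant, ← det_mul_column, ← det_diagonal,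
      ← det_fromBlocks_zero₂₁ _ (of fun i j => (Q j).eval (x i) * (ψ (-z j)).eval (x i)),
      ← det_fromBlocks_zero₁₂ _ (of fun a l => (P * X ^ e l).eval (Sum.elim x z a))]
    congr 1
    ext (i | i | i) (l | j | j)
    · simp [joinPts, hΦ]
    · simp [joinPts, hΦ, hψy]
    · simp [joinPts, hΦ, hψy]
    · simp [joinPts, hΦ]
    · simp [joinPts, hΦ, mul_comm]
    · simp [joinPts, hΦ]
    · simp [joinPts, hΦ]
    · by_cases h : i = j
      · subst h; simp [joinPts, hΦ, hψw]
      · simp [joinPts, hΦ, hQ0 i j h]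
    · by_cases h : i = j
      · subst h; simp [joinPts, hΦ]
      · simp [joinPts, hΦ, hQ0 i j h, h]
  have hA : (∏ i, P.eval (y i)) * alternant e y ≠ 0 := by
    refine mul_ne_zero (Finset.prod_ne_zero_iff.2 fun i _ => ?_) hy
    rw [hPe]
    exact Finset.prod_ne_zero_iff.2 fun k _ => hyz i k
  have hd : ∏ j, ((Q j).eval (z j) * (ψ (-z j)).eval (z j)) ≠ 0 := by
    refine Finset.prod_ne_zero_iff.2 fun j _ => mul_ne_zero ?_ ?_
    · rw [hQe]
      exact Finset.prod_ne_zero_iff.2 fun k hk =>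
        sub_ne_zero.2 fun h => (Finset.mem_erase.1 hk).1 (hz h).symm
    · have := alternant_neg_pair he h2 y (fun _ : Fin 1 => - z j)
      simp only [neg_neg] at this
      rw [hψ, this]
      refine mul_ne_zero (mul_ne_zero ?_ hy) (pairVandermonde_ne_zero (hzz j))
      simpa [Finset.prod_eq_zero_iff] using fun i => hyz i j
  have h1 := (det_eval_eq_alternant_mul (extExp_injective he) Φ hΦs _).symm.trans (key x)
  have h1' := (det_eval_eq_alternant_mul (extExp_injective he) Φ hΦs _).symm.trans
    (key fun i => - z i)
  have hdiag : (of fun i j => (ψ (z j)).eval (-z i) * (Q j).eval (-z i)).det =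
      ∏ j, ((ψ (z j)).eval (-z j) * (Q j).eval (z j)) := by
    rw [← det_diagonal]
    congr 1
    ext i j
    have hneg : (Q j).eval (-z i) = (Q j).eval (z i) := by simp [hQe]
    by_cases h : i = j
    · subst h; simp [hneg]
    · simp [hneg, hQ0 i j h, h]
  rw [hdiag] at h1'
  simp only [hQe, hψ] at h1 h1' hd
  refine mul_left_cancel₀ (mul_ne_zero hA hd) ?_
  linear_combination (alternant (extExp e m) (joinPts y (fun i => -z i) z)) * h1 -
    (alternant (extExp e m) (joinPts y x z)) * h1'

/-- The points are pairwise distinct and no two of them, equal or not, add up to zero. -/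
def GenericPts {ι : Type*} (t : ι → K) : Prop :=
  Function.Injective t ∧ ∀ a b, t a + t b ≠ 0

theorem exists_alternant_mul_eq_det {y : Fin N → K} {x z : Fin m → K}
    (hg : GenericPts (joinPts y x z)) :
    ∃ κ c : K, κ ≠ 0 ∧ c ≠ 0 ∧ ∀ e : Fin N → ℕ, Function.Injective e → StepTwo e →
      alternant e y ≠ 0 →
      alternant (extExp e m) (joinPts y x z) * alternant e y ^ m * κ =
        alternant e y * c *
        (of fun i j => alternant (extExp e 1) (joinPts y (fun _ => x i) (fun _ => z j)) *
          ∏ k ∈ univ.erase j, (x i ^ 2 - z k ^ 2)).det := by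
  obtain ⟨hinj, hadd⟩ := hg
  have hyz : ∀ i k, y i ^ 2 - z k ^ 2 ≠ 0 := fun i k => by
    rw [sq_sub_sq]
    exact mul_ne_zero (hadd (.inl i) (.inr (.inr k)))
      (sub_ne_zero.2 fun h => by simpa using @hinj (.inl i) (.inr (.inr k)) h)
  have hzadd : ∀ i k, z i + z k ≠ 0 := fun i k => hadd (.inr (.inr i)) (.inr (.inr k))
  have hzinj : Function.Injective z := fun i k h => by
    simpa using @hinj (.inr (.inr i)) (.inr (.inr k)) h
  have hzz : Function.Injective fun k => z k ^ 2 := fun i k h => by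
    rcases sq_eq_sq_iff_eq_or_eq_neg.1 h with h | h
    · exact hzinj h
    · exact absurd (eq_neg_iff_add_eq_zero.1 h) (hzadd i k)
  have hneg : ∀ i k, z i ≠ - z k := fun i k h => hzadd i k (eq_neg_iff_add_eq_zero.1 h)
  have hne1 : ∀ k, Function.Injective
      (Sum.elim (fun _ : Fin 1 => z k) (fun _ : Fin 1 => - z k)) := fun k =>
    Function.Injective.sumElim (Function.injective_of_subsingleton _)
      (Function.injective_of_subsingleton _) fun _ _ => hneg k k
  refine ⟨∏ j, ((∏ i, (y i ^ 2 - z j ^ 2)) *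
      pairVandermonde (fun _ : Fin 1 => -z j) (fun _ => z j) *
      ∏ k ∈ univ.erase j, (z j ^ 2 - z k ^ 2)),
    (∏ i, ∏ k, (y i ^ 2 - z k ^ 2)) * pairVandermonde (fun i => -z i) z, ?_, ?_, ?_⟩
  · refine Finset.prod_ne_zero_iff.2 fun j _ => mul_ne_zero (mul_ne_zero ?_ ?_) ?_
    · exact Finset.prod_ne_zero_iff.2 fun i _ => hyz i j
    · exact pairVandermonde_ne_zero (Function.Injective.sumElim
        (Function.injective_of_subsingleton _) (Function.injective_of_subsingleton _)
        fun _ _ => (hneg j j).symm)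
    · exact Finset.prod_ne_zero_iff.2 fun k hk =>
        sub_ne_zero.2 fun h => (Finset.mem_erase.1 hk).1 (hzz h).symm
  · refine mul_ne_zero (Finset.prod_ne_zero_iff.2 fun i _ =>
      Finset.prod_ne_zero_iff.2 fun k _ => hyz i k) (pairVandermonde_ne_zero ?_)
    exact Function.Injective.sumElim (neg_injective.comp hzinj) hzinj
      fun i k => (hneg k i).symm
  · intro e he h2 hy
    have h := alternant_mul_prod_eq he h2 y x z hyz hy hzz hne1
    have h1 : ∀ j, alternant (extExp e 1) (joinPts y (fun _ => -z j) (fun _ => z j)) =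
        (∏ i, (y i ^ 2 - z j ^ 2)) * alternant e y *
          pairVandermonde (fun _ : Fin 1 => -z j) (fun _ => z j) := fun j => by
      simpa using alternant_neg_pair he h2 y (fun _ : Fin 1 => z j)
    rw [alternant_neg_pair he h2] at h
    simp only [h1] at h
    have hpow : alternant e y ^ m = ∏ _j : Fin m, alternant e y := by simp
    rw [hpow, mul_assoc, ← Finset.prod_mul_distrib]
    refine Eq.trans ?_ (h.trans (by ring))
    congr 1
    exact Finset.prod_congr rfl fun j _ => by ring

end Factorization

section Cauchy

open Polynomial Matrix

variable {K : Type*} [Field K] {m : ℕ}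

theorem alternant_val (t : Fin m → K) :
    alternant (fun i : Fin m => (i : ℕ)) t = ∏ i, ∏ j ∈ Ioi i, (t j - t i) :=
  det_vandermonde t

theorem vanderm_eq_prod_Ioi (t : Fin m → K) : vanderm t = ∏ i, ∏ j ∈ Ioi i, (t i - t j) := by
  refine Finset.prod_congr rfl fun i _ => ?_
  rw [← Finset.prod_filter]
  congr 1
  ext j
  simp

theorem prod_erase_sub (z : Fin m → K) :
    ∏ j, ∏ k ∈ univ.erase j, (z k - z j) =
      (∏ j, ∏ k ∈ Ioi j, (z k - z j)) * ∏ j, ∏ k ∈ Ioi j, (z j - z k) := by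
  have h : ∏ j, ∏ k ∈ Ioi j, (z j - z k) = ∏ j, ∏ k ∈ Iio j, (z k - z j) :=
    Finset.prod_comm' (by simp)
  rw [h, ← Finset.prod_mul_distrib]
  refine Finset.prod_congr rfl fun j _ => ?_
  rw [← Finset.prod_union]
  · congr 1
    ext k
    simp only [Finset.mem_erase, Finset.mem_univ, Finset.mem_union, Finset.mem_Ioi,
      Finset.mem_Iio, and_true]
    exact ne_iff_gt_or_lt
  · rw [Finset.disjoint_left]
    intro k h1 h2
    exact lt_asymm (Finset.mem_Ioi.1 h1) (Finset.mem_Iio.1 h2)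

theorem det_inv_add_eq (x z : Fin m → K) (hz : Function.Injective z)
    (hxz : ∀ i j, x i + z j ≠ 0) :
    (of fun i j => 1 / (x i + z j)).det =
      vanderm x * vanderm z / ∏ i, ∏ j, (x i + z j) := by
  set Q : Fin m → K[X] := fun j => ∏ k ∈ univ.erase j, (X + C (z k)) with hQ
  have hQe : ∀ j s, (Q j).eval s = ∏ k ∈ univ.erase j, (s + z k) := fun j s => by
    simp [hQ, eval_prod]
  have hsupp : ∀ l k, (Q l).coeff k ≠ 0 → k ∈ Set.range (fun i : Fin m => (i : ℕ)) := by
    intro l k hk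
    have hle := le_natDegree_of_ne_zero hk
    rw [hQ, natDegree_prod_of_monic _ _ fun k _ => monic_X_add_C _] at hle
    simp only [natDegree_X_add_C, Finset.sum_const, smul_eq_mul, mul_one,
      Finset.card_erase_of_mem (Finset.mem_univ l), Finset.card_univ, Fintype.card_fin] at hle
    have := l.isLt
    exact ⟨⟨k, by omega⟩, rfl⟩
  have hx := det_eval_eq_alternant_mul Fin.val_injective Q hsupp x
  have hz' := det_eval_eq_alternant_mul Fin.val_injective Q hsupp fun i => - z i
  have hdiag : (of fun i j => (Q j).eval (- z i)).det =
      ∏ j, ∏ k ∈ univ.erase j, (z k - z j) := by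
    rw [← det_diagonal]
    congr 1
    ext i j
    rw [of_apply, hQe]
    by_cases h : i = j
    · subst h; simp [neg_add_eq_sub]
    · rw [diagonal_apply_ne _ h]
      exact Finset.prod_eq_zero (Finset.mem_erase.2 ⟨h, Finset.mem_univ i⟩) (neg_add_cancel _)
  have hne : ∏ j, ∏ k ∈ Ioi j, (z j - z k) ≠ 0 :=
    Finset.prod_ne_zero_iff.2 fun j _ => Finset.prod_ne_zero_iff.2 fun k hk =>
      sub_ne_zero.2 fun h => (Finset.mem_Ioi.1 hk).ne (hz h)
  have hsub : ∀ i j, - z j - - z i = z i - z j := fun i j => by ring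
  rw [hdiag, prod_erase_sub, alternant_val] at hz'
  simp only [hsub] at hz'
  have hC := mul_left_cancel₀ hne ((mul_comm _ _).trans hz')
  have hcols : (of fun i j => (Q j).eval (x i)).det =
      (∏ i, ∏ j, (x i + z j)) * (of fun i j => 1 / (x i + z j)).det := by
    rw [← det_mul_column]
    congr 1
    ext i j
    rw [of_apply, of_apply, hQe, ← Finset.mul_prod_erase univ _ (Finset.mem_univ j), of_apply]
    field_simp [hxz i j]
  have hprod : ∏ i, ∏ j, (x i + z j) ≠ 0 :=
    Finset.prod_ne_zero_iff.2 fun i _ => Finset.prod_ne_zero_iff.2 fun j _ => hxz i j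
  rw [eq_div_iff hprod, mul_comm, ← hcols, hx, ← hC, alternant_val, vanderm_eq_prod_Ioi,
    vanderm_eq_prod_Ioi]
  simp only [← Finset.prod_mul_distrib]
  exact Finset.prod_congr rfl fun i _ => Finset.prod_congr rfl fun j _ => by ring

end Cauchy

section Ratio

open Matrix

variable {K : Type*} [Field K] {N m : ℕ} {e : Fin N → ℕ}

theorem stepTwo_val : StepTwo fun l : Fin N => (l : ℕ) := fun l => by
  by_cases h : (l : ℕ) < 2
  · exact .inl h
  · exact .inr ⟨⟨l - 2, by omega⟩, by simp only; omega⟩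

theorem alternant_extExp_val_ne_zero {t : Fin N ⊕ (Fin m ⊕ Fin m) → K}
    (ht : Function.Injective t) : alternant (extExp (fun l : Fin N => (l : ℕ)) m) t ≠ 0 := by
  let τ : Fin N ⊕ (Fin m ⊕ Fin m) ≃ Fin (m + m + N) :=
    (Equiv.sumComm _ _).trans ((Equiv.sumCongr finSumFinEquiv (Equiv.refl _)).trans finSumFinEquiv)
  have h : extExp (fun l : Fin N => (l : ℕ)) m = fun a => (τ a : ℕ) := by
    ext (a | a | a) <;> simp [extExp, τ] <;> omega
  rw [h]
  exact alternant_ne_zero τ ht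

theorem det_alternant_div (hm : 1 ≤ m) {y : Fin N → K} {x z : Fin m → K}
    (hg : GenericPts (joinPts y x z)) (he : Function.Injective e) (h2 : StepTwo e)
    (hy : alternant e y ≠ 0) :
    (of fun i j => alternant (extExp e 1) (joinPts y (fun _ => x i) (fun _ => z j)) /
        alternant (extExp (fun l : Fin N => (l : ℕ)) 1)
          (joinPts y (fun _ => x i) (fun _ => z j)) / (x i + z j)).det =
      vanderm x * vanderm z / (∏ i, ∏ j, (x i + z j)) *
        (alternant e y / alternant (fun l : Fin N => (l : ℕ)) y) ^ (m - 1) *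
        (alternant (extExp e m) (joinPts y x z) /
          alternant (extExp (fun l : Fin N => (l : ℕ)) m) (joinPts y x z)) := by
  obtain ⟨κ, c, hκ, hc, H⟩ := exists_alternant_mul_eq_det hg
  obtain ⟨hinj, hadd⟩ := hg
  have hyinj : Function.Injective y := fun i k h => by
    simpa using @hinj (.inl i) (.inl k) h
  have hzinj : Function.Injective z := fun i k h => by
    simpa using @hinj (.inr (.inr i)) (.inr (.inr k)) h
  have hxz : ∀ i j, x i + z j ≠ 0 := fun i j => hadd (.inr (.inl i)) (.inr (.inr j))
  have hd0 : alternant (fun l : Fin N => (l : ℕ)) y ≠ 0 := alternant_ne_zero (.refl _) hyinj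
  have hF0 := alternant_extExp_val_ne_zero hinj
  have hφ0 : ∀ i j, alternant (extExp (fun l : Fin N => (l : ℕ)) 1)
      (joinPts y (fun _ => x i) (fun _ => z j)) ≠ 0 := fun i j => by
    have hι : joinPts y (fun _ : Fin 1 => x i) (fun _ => z j) =
        joinPts y x z ∘ Sum.map id (Sum.map (fun _ => i) (fun _ => j)) := by
      ext (a | a | a) <;> rfl
    refine alternant_extExp_val_ne_zero ?_
    rw [hι]
    exact hinj.comp (Function.injective_id.sumMap ((Function.injective_of_subsingleton _).sumMap
      (Function.injective_of_subsingleton _)))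
  have hM : ∀ s : Fin m → Fin m → K,
      (of fun i j => s i j * alternant (extExp (fun l : Fin N => (l : ℕ)) 1)
        (joinPts y (fun _ => x i) (fun _ => z j)) *
          ∏ k ∈ univ.erase j, (x i ^ 2 - z k ^ 2)).det =
      (∏ i, (-alternant (fun l : Fin N => (l : ℕ)) y * (∏ l, (y l - x i)) *
        ∏ k, (x i ^ 2 - z k ^ 2))) * ((∏ j, ∏ l, (y l - z j)) *
          (of fun i j => s i j / (x i + z j)).det) := by
    intro s
    rw [← det_mul_row, ← det_mul_column]
    congr 1
    ext i j
    rw [of_apply, of_apply, of_apply, of_apply, alternant_val_pair,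
      ← Finset.mul_prod_erase univ _ (Finset.mem_univ j)]
    field_simp [hxz i j]
    ring
  have H0 := H _ Fin.val_injective stepTwo_val hd0
  have H1 := H e he h2 hy
  have hM0 := hM fun _ _ => 1
  simp only [one_mul] at hM0
  have hM1 := hM fun i j => alternant (extExp e 1) (joinPts y (fun _ => x i) (fun _ => z j)) /
        alternant (extExp (fun l : Fin N => (l : ℕ)) 1) (joinPts y (fun _ => x i) (fun _ => z j))
  simp only [div_mul_cancel₀ _ (hφ0 _ _)] at hM1
  rw [hM0, det_inv_add_eq x z hzinj hxz] at H0
  rw [hM1] at H1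
  obtain ⟨n, rfl⟩ : ∃ n, m = n + 1 := ⟨m - 1, by omega⟩
  rw [Nat.add_sub_cancel]
  generalize vanderm x * vanderm z / (∏ i, ∏ j, (x i + z j)) = W at *
  generalize (∏ i, (-alternant (fun l : Fin N => (l : ℕ)) y * (∏ l, (y l - x i)) *
        ∏ k, (x i ^ 2 - z k ^ 2))) = A at *
  generalize ∏ j, ∏ l, (y l - z j) = B at *
  generalize (of fun i j => alternant (extExp e 1) (joinPts y (fun _ => x i) (fun _ => z j)) /
    alternant (extExp (fun l : Fin N => (l : ℕ)) 1)
      (joinPts y (fun _ => x i) (fun _ => z j)) / (x i + z j)).det = S at *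
  generalize alternant (extExp e (n + 1)) (joinPts y x z) = F at *
  generalize alternant (extExp (fun l : Fin N => (l : ℕ)) (n + 1)) (joinPts y x z) = F0 at *
  generalize alternant e y = d at *
  generalize alternant (fun l : Fin N => (l : ℕ)) y = d0 at *
  have H0' : F0 * d0 ^ n * κ = c * (A * (B * W)) := by
    refine mul_left_cancel₀ hd0 ?_
    linear_combination H0
  have H1' : F * d ^ n * κ = c * (A * (B * S)) := by
    refine mul_left_cancel₀ hy ?_
    linear_combination H1
  have hne : c * (A * (B * W)) ≠ 0 := by
    rw [← H0']
    exact mul_ne_zero (mul_ne_zero hF0 (pow_ne_zero _ hd0)) hκ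
  have hAB : c * (A * B) ≠ 0 := by
    intro h
    exact hne (by linear_combination W * h)
  rw [div_pow, mul_div_assoc', mul_div_assoc', div_mul_eq_mul_div, div_div,
    eq_div_iff (mul_ne_zero (pow_ne_zero _ hd0) hF0)]
  refine mul_left_cancel₀ hAB ?_
  linear_combination F * d ^ n * H0' - F0 * d0 ^ n * H1'

end Ratio

section Staircase

open Matrix

variable {K : Type*} [Field K]

/-- The exponents `ρⱼ + j` of the staircase `ρ = (r, …, 1)` padded to length `N`. -/
def staircaseExp (r N : ℕ) (j : Fin N) : ℕ :=
  padIncr r N (staircase r) j + j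

theorem staircaseExp_eq (r N : ℕ) (j : Fin N) :
    staircaseExp r N j = if N - 1 - (j : ℕ) < r then r - (N - 1 - j) + j else (j : ℕ) := by
  unfold staircaseExp padIncr staircase
  split_ifs <;> simp

theorem staircaseExp_injective (r N : ℕ) : Function.Injective (staircaseExp r N) := by
  intro i j h
  rw [staircaseExp_eq, staircaseExp_eq] at h
  ext
  split_ifs at h <;> omega

theorem stepTwo_staircaseExp {r N : ℕ} (h : r ≤ N) : StepTwo (staircaseExp r N) := by
  intro l
  simp only [staircaseExp_eq]
  by_cases h1 : N - 1 - (l : ℕ) < r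
  · by_cases h2 : r - (N - 1 - (l : ℕ)) + l < 2
    · left; rwa [if_pos h1]
    · right
      by_cases h3 : (l : ℕ) = N - r
      · refine ⟨⟨l - 1, by omega⟩, ?_⟩
        simp only
        split_ifs <;> omega
      · refine ⟨⟨l - 1, by omega⟩, ?_⟩
        simp only
        split_ifs <;> omega
  · by_cases h2 : (l : ℕ) < 2
    · left; rwa [if_neg h1]
    · right
      refine ⟨⟨l - 2, by omega⟩, ?_⟩
      simp only
      split_ifs <;> omega

theorem schur_staircase_eq (r N : ℕ) (t : Fin N → K) :
    schur (padIncr r N (staircase r)) t =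
      alternant (staircaseExp r N) t / alternant (fun l : Fin N => (l : ℕ)) t :=
  rfl

theorem schur_staircase_joinPts {r N m p : ℕ} (hp : p = N + 2 * m) (h : r ≤ N)
    (t : Fin p → K) (y : Fin N → K) (x z : Fin m → K)
    (hy : ∀ i : Fin N, t ⟨i, by omega⟩ = y i) (hx : ∀ i : Fin m, t ⟨N + i, by omega⟩ = x i)
    (hz : ∀ i : Fin m, t ⟨N + m + i, by omega⟩ = z i) :
    schur (padIncr r p (staircase r)) t =
      alternant (extExp (staircaseExp r N) m) (joinPts y x z) /
        alternant (extExp (fun l : Fin N => (l : ℕ)) m) (joinPts y x z) := by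
  let τ : Fin N ⊕ (Fin m ⊕ Fin m) ≃ Fin p :=
    ((Equiv.sumComm _ _).trans ((Equiv.sumCongr finSumFinEquiv (Equiv.refl _)).trans
      finSumFinEquiv)).trans (finCongr (by omega : m + m + N = p))
  let σ : Fin N ⊕ (Fin m ⊕ Fin m) ≃ Fin p :=
    ((Equiv.sumCongr (Equiv.refl _) finSumFinEquiv).trans finSumFinEquiv).trans
      (finCongr (by omega : N + (m + m) = p))
  have ht : joinPts y x z = t ∘ σ := by
    ext (i | i | i)
    · exact (hy i).symm
    · exact (hx i).symm
    · refine (hz i).symm.trans (congrArg t (Fin.ext ?_))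
      simp [σ, add_comm, add_left_comm]
  have h0 : extExp (fun l : Fin N => (l : ℕ)) m = (fun l : Fin p => (l : ℕ)) ∘ τ := by
    ext (a | a | a) <;> simp [extExp, τ] <;> omega
  have h1 : extExp (staircaseExp r N) m = staircaseExp r p ∘ τ := by
    ext (a | a | a) <;> simp only [extExp, τ, staircaseExp_eq, Sum.elim_inl, Sum.elim_inr,
      Function.comp_apply, Equiv.trans_apply, Equiv.sumComm_apply, Sum.swap_inl, Sum.swap_inr,
      Equiv.sumCongr_apply, Sum.map_inl, Sum.map_inr, Equiv.refl_apply, finCongr_apply, Fin.val_cast,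
      finSumFinEquiv_apply_left, finSumFinEquiv_apply_right, Fin.val_castAdd, Fin.val_natAdd] <;>
      split_ifs <;> omega
  rw [schur_staircase_eq, h0, h1, ht, alternant_comp_equiv, alternant_comp_equiv,
    mul_div_mul_left]
  rcases Int.units_eq_one_or (Equiv.Perm.sign (τ.symm.trans σ)) with h | h <;> simp [h]

theorem alternant_two_pow_ne_zero {N : ℕ} {e : Fin N → ℕ} (he : Function.Injective e) :
    alternant e (fun i => (2 : ℚ) ^ (i : ℕ)) ≠ 0 := by
  have h : alternant e (fun i => (2 : ℚ) ^ (i : ℕ)) =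
      (vandermonde fun j => (2 : ℚ) ^ e j).det := by
    rw [alternant, ← det_transpose]
    congr 1
    ext i j
    simp [vandermonde_apply, ← pow_mul, mul_comm]
  rw [h, det_vandermonde_ne_zero_iff]
  exact (pow_right_injective₀ two_pos (by norm_num)).comp he

theorem alternant_Y14_ne_zero {N n : ℕ} {e : Fin N → ℕ} (he : Function.Injective e) :
    alternant e (Y14 N n) ≠ 0 := by
  have h : alternant e (Y14 N n) = algebraMap (MvPolynomial (Fin N ⊕ Fin n) ℚ) _
      (of fun i j => (MvPolynomial.X (Sum.inl i) : MvPolynomial (Fin N ⊕ Fin n) ℚ) ^ e j).det := by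
    rw [alternant, RingHom.map_det]
    congr 1
    ext i j
    simp [Y14]
  rw [h]
  refine (map_ne_zero_iff _ (IsFractionRing.injective _ _)).2 fun h0 => ?_
  apply alternant_two_pow_ne_zero he
  have h1 := congrArg (MvPolynomial.eval
    (Sum.elim (fun i : Fin N => (2 : ℚ) ^ (i : ℕ)) fun _ => 0)) h0
  rw [RingHom.map_det, map_zero] at h1
  rw [← h1, alternant]
  congr 1
  ext i j
  simp

theorem genericPts_algebraMap_X {ι α : Type*} (f : ι → α) (hf : Function.Injective f) :
    GenericPts fun i => algebraMap (MvPolynomial α ℚ) (FractionRing (MvPolynomial α ℚ))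
      (MvPolynomial.X (f i)) := by
  have hinj := IsFractionRing.injective (MvPolynomial α ℚ) (FractionRing (MvPolynomial α ℚ))
  refine ⟨hinj.comp ((MvPolynomial.X_injective).comp hf), fun a b h => ?_⟩
  rw [← map_add, map_eq_zero_iff _ hinj] at h
  simpa using congrArg (MvPolynomial.eval fun _ => (1 : ℚ)) h

end Staircase

/-- Factorization of the determinant of Schur functions of the staircase `ρ = (r,…,1)`:
`det( s_ρ(y, xᵢ, x_{m+j})/(xᵢ + x_{m+j}) )_{1≤i,j≤m}
 = (Δ(x₁,…,x_m)·Δ(x_{m+1},…,x_n)/∏_{1≤i≤m<j≤n}(xᵢ+xⱼ)) · (s_ρ(y))^{m-1} · s_ρ(y, x₁,…,x_n)`. -/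
theorem det_staircase_schur (N m r : ℕ) (hm : 1 ≤ m) (hr : 1 ≤ r) (hrN : r ≤ N) :
    Matrix.det (Matrix.of fun i j : Fin m =>
        schur (padIncr r (N + 2) (staircase r))
            (fun q : Fin (N + 2) =>
              if h : (q : ℕ) < N then Y14 N (2 * m) ⟨q, h⟩
              else if (q : ℕ) = N then X14 N (2 * m) ⟨i.val, by omega⟩
              else X14 N (2 * m) ⟨m + j.val, by omega⟩) /
          (X14 N (2 * m) ⟨i.val, by omega⟩ + X14 N (2 * m) ⟨m + j.val, by omega⟩))
      = (vanderm (fun i : Fin m => X14 N (2 * m) ⟨i.val, by omega⟩) *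
            vanderm (fun i : Fin m => X14 N (2 * m) ⟨m + i.val, by omega⟩) /
          (∏ i : Fin m, ∏ j : Fin m,
            (X14 N (2 * m) ⟨i.val, by omega⟩ + X14 N (2 * m) ⟨m + j.val, by omega⟩))) *
          schur (padIncr r N (staircase r)) (Y14 N (2 * m)) ^ (m - 1) *
          schur (padIncr r (N + 2 * m) (staircase r))
            (fun q : Fin (N + 2 * m) =>
              if h : (q : ℕ) < N then Y14 N (2 * m) ⟨q, h⟩
              else X14 N (2 * m) ⟨(q : ℕ) - N, by omega⟩) := by
  set x : Fin m → RatFunc14 N (2 * m) := fun i => X14 N (2 * m) ⟨i.val, by omega⟩ with hx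
  set z : Fin m → RatFunc14 N (2 * m) := fun j => X14 N (2 * m) ⟨m + j.val, by omega⟩ with hz
  have hg : GenericPts (joinPts (Y14 N (2 * m)) x z) := by
    have hjoin : joinPts (Y14 N (2 * m)) x z = fun a => algebraMap
        (MvPolynomial (Fin N ⊕ Fin (2 * m)) ℚ) (RatFunc14 N (2 * m)) (MvPolynomial.X
          (Sum.map id (Sum.elim (fun i : Fin m => (⟨i, by omega⟩ : Fin (2 * m)))
            fun j : Fin m => ⟨m + j, by omega⟩) a)) := by
      ext (a | a | a) <;> rfl
    rw [hjoin]
    refine genericPts_algebraMap_X _ (Function.injective_id.sumMap ?_)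
    rintro (a | a) (b | b) h <;> simp [Fin.ext_iff] at h ⊢ <;> omega
  have hmain := det_alternant_div hm hg (staircaseExp_injective r N) (stepTwo_staircaseExp hrN)
    (alternant_Y14_ne_zero (staircaseExp_injective r N))
  rw [schur_staircase_eq, schur_staircase_joinPts rfl hrN _ (Y14 N (2 * m)) x z]
  · refine Eq.trans ?_ hmain
    congr 1
    ext i j
    rw [Matrix.of_apply, Matrix.of_apply, schur_staircase_joinPts (m := 1) rfl hrN _
      (Y14 N (2 * m)) (fun _ => x i) (fun _ => z j)]
    · intro k
      simp
    · intro k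
      simp [hx]
    · intro k
      simp [hz]
  · intro i
    simp
  · intro i
    simp [hx]
  · intro i
    simp [hz, add_assoc]
end
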